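/- Let H be an abelian group, b: H → 𝕋 a map with b(0) = 1, and ν the normalized scalar 2-cocycle ν(g,h) = b(g)·b(h)·conj(b(g+h)). Fix a bijection ℕ → ℤ², j ↦ k_j. Then for every λ ∈ Λ(H) one has ν̂(λ) = ∏_{k∈ℤ²} b(λ(k)), and consequently ν̂(λ₁)·ν̂(λ₂) = ν̃(λ₁,λ₂)·ν̂(λ₁+λ₂) for all λ₁, λ₂ ∈ Λ(H). -/

import Mathlib

/-- `λ ∈ Λ(H)`: a finitely supported function `λ : ℤ² → H` with `∑_{k} λ(k) = 0`. -/
def InLambda {H : Type*} [AddCommGroup H] (l : (Fin 2 → ℤ) →₀ H) : Prop :=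
  ∑ k ∈ l.support, l k = 0

/-- `ν̃(λ₁,λ₂) = ∏_{k ∈ ℤ²} ν(λ₁(k), λ₂(k))` (all but finitely many factors are `1`). -/
noncomputable def tilde2Cocycle {H : Type*} [AddCommGroup H] (ν : H → H → ℂ)
    (l₁ l₂ : (Fin 2 → ℤ) →₀ H) : ℂ :=
  ∏ᶠ k : Fin 2 → ℤ, ν (l₁ k) (l₂ k)

/-- Given a bijection `ℕ ≃ ℤ²`, `j ↦ k_j`,
`ν̂(λ) = ∏_j ν(∑_{i<j} λ(k_i), λ(k_j))` (all but finitely many factors are `1`). -/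
noncomputable def hat2Cocycle {H : Type*} [AddCommGroup H] (e : ℕ ≃ (Fin 2 → ℤ))
    (ν : H → H → ℂ) (l : (Fin 2 → ℤ) →₀ H) : ℂ :=
  ∏ᶠ j : ℕ, ν (∑ i ∈ Finset.range j, l (e i)) (l (e j))

theorem exists_bound_aux {H : Type*} [AddCommGroup H] (e : ℕ ≃ (Fin 2 → ℤ))
    (l : (Fin 2 → ℤ) →₀ H) : ∃ N : ℕ, ∀ j, l (e j) ≠ 0 → j < N := by
  refine ⟨(l.support.image e.symm).sup id + 1, fun j hj => ?_⟩
  have hmem : j ∈ l.support.image e.symm := by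
    rw [Finset.mem_image]
    exact ⟨e j, by simpa using hj, by simp⟩
  exact Nat.lt_succ_of_le (Finset.le_sup (f := id) hmem)

theorem hat_eq_aux {H : Type*} [AddCommGroup H] (e : ℕ ≃ (Fin 2 → ℤ))
    (b : H → ℂ) (hb : ∀ g, ‖b g‖ = 1) (hb0 : b 0 = 1)
    (ν : H → H → ℂ)
    (hν : ∀ g h, ν g h = b g * b h * (starRingEnd ℂ) (b (g + h)))
    (l : (Fin 2 → ℤ) →₀ H) (hl : InLambda l) :
    hat2Cocycle e ν l = ∏ᶠ k : Fin 2 → ℤ, b (l k) := by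
  have hbb : ∀ g, b g * (starRingEnd ℂ) (b g) = 1 := fun g => by
    rw [Complex.mul_conj, Complex.normSq_eq_norm_sq, hb]; simp
  have hν0 : ∀ g, ν g 0 = 1 := fun g => by rw [hν, hb0, add_zero, mul_one, hbb]
  obtain ⟨N, hN⟩ := exists_bound_aux e l
  have hsum : ∑ i ∈ Finset.range N, l (e i) = 0 := by
    have h1 : ∑ i ∈ Finset.range N, l (e i) = ∑ᶠ i, l (e i) :=
      (finsum_eq_sum_of_support_subset _ (by
        intro j hj
        simpa using hN j hj)).symm
    have h2 : ∑ᶠ k, l k = ∑ k ∈ l.support, l k :=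
      finsum_eq_sum_of_support_subset _ (by
        intro j hj
        simpa using hj)
    rw [h1, finsum_comp_equiv e (f := fun k => l k), h2]
    exact hl
  have hR : ∏ᶠ k, b (l k) = ∏ j ∈ Finset.range N, b (l (e j)) := by
    rw [← finprod_comp_equiv e (f := fun k => b (l k))]
    refine finprod_eq_prod_of_mulSupport_subset _ ?_
    intro j hj
    have : l (e j) ≠ 0 := fun h => hj (by simp [h, hb0])
    simpa using hN j this
  have hL : hat2Cocycle e ν l
      = ∏ j ∈ Finset.range N, ν (∑ i ∈ Finset.range j, l (e i)) (l (e j)) := by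
    refine finprod_eq_prod_of_mulSupport_subset _ ?_
    intro j hj
    have : l (e j) ≠ 0 := fun h => hj (by simp [h, hν0])
    simpa using hN j this
  have key : ∀ n, ∏ j ∈ Finset.range n, ν (∑ i ∈ Finset.range j, l (e i)) (l (e j))
      = (∏ j ∈ Finset.range n, b (l (e j)))
        * (starRingEnd ℂ) (b (∑ i ∈ Finset.range n, l (e i))) := by
    intro n
    induction n with
    | zero => simp [hb0]
    | succ n ih =>
      rw [Finset.prod_range_succ, Finset.prod_range_succ, ih, Finset.sum_range_succ, hν]
      linear_combination (∏ j ∈ Finset.range n, b (l (e j))) * b (l (e n))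
        * (starRingEnd ℂ) (b (∑ i ∈ Finset.range n, l (e i) + l (e n)))
        * hbb (∑ i ∈ Finset.range n, l (e i))
  rw [hL, hR, key, hsum, hb0]
  simp

/-- Let `b : H → 𝕋` with `b 0 = 1` and let `ν` be the coboundary 2-cocycle
`ν(g,h) = b(g)·b(h)·conj(b(g+h))`. Then `ν̂(λ) = ∏_{k ∈ ℤ²} b(λ(k))` for `λ ∈ Λ(H)`,
and consequently `ν̂(λ₁)·ν̂(λ₂) = ν̃(λ₁,λ₂)·ν̂(λ₁+λ₂)` for all `λ₁, λ₂ ∈ Λ(H)`. -/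
theorem hat_coboundary {H : Type*} [AddCommGroup H] (e : ℕ ≃ (Fin 2 → ℤ))
    (b : H → ℂ) (hb : ∀ g, ‖b g‖ = 1) (hb0 : b 0 = 1)
    (ν : H → H → ℂ)
    (hν : ∀ g h, ν g h = b g * b h * (starRingEnd ℂ) (b (g + h))) :
    (∀ l : (Fin 2 → ℤ) →₀ H, InLambda l →
      hat2Cocycle e ν l = ∏ᶠ k : Fin 2 → ℤ, b (l k)) ∧
    (∀ l₁ l₂ : (Fin 2 → ℤ) →₀ H, InLambda l₁ → InLambda l₂ →
      hat2Cocycle e ν l₁ * hat2Cocycle e ν l₂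
        = tilde2Cocycle ν l₁ l₂ * hat2Cocycle e ν (l₁ + l₂)) := by
  have hbb : ∀ g, b g * (starRingEnd ℂ) (b g) = 1 := fun g => by
    rw [Complex.mul_conj, Complex.normSq_eq_norm_sq, hb]; simp
  have h1 := hat_eq_aux e b hb hb0 ν hν
  refine ⟨h1, fun l₁ l₂ hl₁ hl₂ => ?_⟩
  have hadd : InLambda (l₁ + l₂) := by
    have h : (l₁ + l₂).sum (fun _ x => x) = l₁.sum (fun _ x => x) + l₂.sum (fun _ x => x) :=
      Finsupp.sum_add_index' (fun _ => rfl) (fun _ _ _ => rfl)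
    have e1 : l₁.sum (fun _ x => x) = 0 := hl₁
    have e2 : l₂.sum (fun _ x => x) = 0 := hl₂
    rw [e1, e2, add_zero] at h
    exact h
  have hfin : ∀ l : (Fin 2 → ℤ) →₀ H,
      (Function.mulSupport fun k => b (l k)).Finite := fun l =>
    l.support.finite_toSet.subset (by
      intro k hk
      have : l k ≠ 0 := fun h => hk (by simp [h, hb0])
      simpa using this)
  have hfν : (Function.mulSupport fun k => ν (l₁ k) (l₂ k)).Finite :=
    (l₁.support.finite_toSet.union l₂.support.finite_toSet).subset (by
      intro k hk
      by_contra hc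
      simp only [Set.mem_union, Finset.mem_coe, Finsupp.mem_support_iff, not_or, not_not] at hc
      exact hk (by simp [hc.1, hc.2, hν, hb0]))
  rw [h1 _ hl₁, h1 _ hl₂, h1 _ hadd, tilde2Cocycle,
    ← finprod_mul_distrib (hfin l₁) (hfin l₂), ← finprod_mul_distrib hfν (hfin (l₁ + l₂))]
  refine finprod_congr fun k => ?_
  rw [hν, Finsupp.add_apply]
  linear_combination (-(b (l₁ k) * b (l₂ k))) * hbb (l₁ k + l₂ k)
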